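/- (Minimizer of the importance-weighted denoising score matching objective.) Define the weighted objective J(s) = ∫∫ (q₀(x₀)/p₀(x₀)) · ‖s(x) − ∇_x log k(x₀, x)‖² k(x₀, x) p₀(x₀) dx₀ dx over measurable vector fields s : ℝ^d → ℝ^d, and define s*(x) = ( ∫ (q₀(x₀)/p₀(x₀)) · ∇_x log k(x₀, x) · p(x₀ | x) dx₀ ) / ( ∫ (q₀(x₀)/p₀(x₀)) · p(x₀ | x) dx₀ ). Then J(s*) ≤ J(s) for every measurable s with J(s) < ∞; that is, the importance-weighted posterior average of the conditional transition score is a global minimizer of the importance-weighted denoising score matching objective. -/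

import Mathlib

open MeasureTheory

noncomputable section

/-- `ℝ^d` with its Euclidean structure. -/
abbrev Euc (d : ℕ) := EuclideanSpace ℝ (Fin d)

/-- A strictly positive integrable function has strictly positive integral. -/
theorem integral_pos_of_forall_pos {α : Type*} [MeasurableSpace α] {μ : Measure α} [NeZero μ]
    {f : α → ℝ} (hf : Integrable f μ) (hpos : ∀ a, 0 < f a) : 0 < ∫ a, f a ∂μ := by
  rw [integral_pos_iff_support_of_nonneg (fun a => (hpos a).le) hf,
    Function.support_eq_univ fun a => (hpos a).ne']
  exact Measure.measure_univ_pos.2 (NeZero.ne μ)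

/-- The weighted mean minimizes the weighted mean squared distance. -/
theorem lintegral_norm_sub_weightedMean_sq_le {α E : Type*} [MeasurableSpace α] {μ : Measure α}
    [NormedAddCommGroup E] [InnerProductSpace ℝ E] [CompleteSpace E] {w : α → ℝ} {g : α → E}
    (hw : Integrable w μ) (hw_nonneg : ∀ a, 0 ≤ w a) (hw_pos : 0 < ∫ a, w a ∂μ)
    (hg : AEStronglyMeasurable g μ) (c : E) :
    ∫⁻ a, ENNReal.ofReal (w a * ‖(∫ b, w b ∂μ)⁻¹ • ∫ b, w b • g b ∂μ - g a‖ ^ 2) ∂μ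
      ≤ ∫⁻ a, ENNReal.ofReal (w a * ‖c - g a‖ ^ 2) ∂μ := by
  rcases eq_or_ne (∫⁻ a, ENNReal.ofReal (w a * ‖c - g a‖ ^ 2) ∂μ) ⊤ with htop | hfin
  · exact htop ▸ le_top
  have hc : Integrable (fun a => w a * ‖c - g a‖ ^ 2) μ := by
    refine (lintegral_ofReal_ne_top_iff_integrable ?_ (ae_of_all _ fun a => ?_)).1 hfin
    · exact hw.aestronglyMeasurable.mul ((aestronglyMeasurable_const.sub hg).norm.pow 2)
    · exact mul_nonneg (hw_nonneg a) (sq_nonneg _)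
  have hwg : Integrable (fun a => w a • g a) μ := by
    refine ((hw.mul_const (‖c‖ + 1)).add hc).mono' (hw.aestronglyMeasurable.smul hg)
      (ae_of_all _ fun a => ?_)
    have htri : ‖g a‖ ≤ ‖c‖ + ‖c - g a‖ := by
      simpa using norm_sub_le c (c - g a)
    have hle : ‖g a‖ ≤ (‖c‖ + 1) + ‖c - g a‖ ^ 2 := by
      nlinarith [sq_nonneg (‖c - g a‖ - 1), norm_nonneg (c - g a)]
    rw [norm_smul, Real.norm_of_nonneg (hw_nonneg a), Pi.add_apply, ← mul_add]
    exact mul_le_mul_of_nonneg_left hle (hw_nonneg a)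
  set m := (∫ b, w b ∂μ)⁻¹ • ∫ b, w b • g b ∂μ with hm
  have hcross : Integrable (fun a => w a • m - w a • g a) μ := (hw.smul_const m).sub hwg
  have hcross_zero : ∫ a, (w a • m - w a • g a) ∂μ = 0 := by
    rw [integral_sub (hw.smul_const m) hwg, integral_smul_const, hm,
      smul_inv_smul₀ hw_pos.ne', sub_self]
  have hexpand : ∀ a, w a * ‖m - g a‖ ^ 2 = w a * ‖c - g a‖ ^ 2 -
      (w a * ‖c - m‖ ^ 2 + 2 * inner ℝ (c - m) (w a • m - w a • g a)) := by
    intro a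
    have hsq := norm_add_sq_real (c - m) (m - g a)
    rw [sub_add_sub_cancel] at hsq
    rw [hsq, ← smul_sub, real_inner_smul_right]
    ring
  have hrem : Integrable (fun a => w a * ‖c - m‖ ^ 2 +
      2 * inner ℝ (c - m) (w a • m - w a • g a)) μ := (hw.mul_const (‖c - m‖ ^ 2)).add ((hcross.const_inner (c - m)).const_mul 2)
  have hmint : Integrable (fun a => w a * ‖m - g a‖ ^ 2) μ := by
    simp_rw [hexpand]
    exact hc.sub hrem
  have hnonneg : ∀ v : E, 0 ≤ᵐ[μ] fun a => w a * ‖v - g a‖ ^ 2 := fun v =>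
    ae_of_all _ fun a => mul_nonneg (hw_nonneg a) (sq_nonneg _)
  rw [← ofReal_integral_eq_lintegral_ofReal hc (hnonneg c),
    ← ofReal_integral_eq_lintegral_ofReal hmint (hnonneg m)]
  refine ENNReal.ofReal_le_ofReal ?_
  have hval : ∫ a, w a * ‖m - g a‖ ^ 2 ∂μ
      = (∫ a, w a * ‖c - g a‖ ^ 2 ∂μ) - (∫ a, w a ∂μ) * ‖c - m‖ ^ 2 := by
    simp_rw [hexpand]
    rw [integral_sub hc hrem,
      integral_add (hw.mul_const _) ((hcross.const_inner (c - m)).const_mul 2),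
      integral_mul_const, integral_const_mul, integral_inner hcross, hcross_zero,
      inner_zero_right, mul_zero, add_zero]
  rw [hval]
  exact sub_le_self _ (mul_nonneg hw_pos.le (sq_nonneg _))

/-- The gradient at a point of a parametric family of differentiable functions depends measurably
on the parameter. -/
theorem measurable_gradient_param {α : Type*} [MeasurableSpace α] {d : ℕ} {f : α → Euc d → ℝ}
    (x : Euc d) (hf : ∀ y, Measurable fun a => f a y)
    (hdiff : ∀ a, DifferentiableAt ℝ (f a) x) :
    Measurable fun a => gradient (f a) x := by
  have hcoord : ∀ v : Euc d, Measurable fun a => fderiv ℝ (f a) x v := by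
    intro v
    refine measurable_of_tendsto_metrizable
      (f := fun (n : ℕ) a => (n : ℝ) • (f a (x + (n : ℝ)⁻¹ • v) - f a x))
      (fun n => ((hf (x + (n : ℝ)⁻¹ • v)).sub (hf x)).const_smul (n : ℝ)) (tendsto_pi_nhds.2 fun a => ?_)
    exact ((hdiff a).hasFDerivAt.lim_real v).comp tendsto_natCast_atTop_atTop
  refine (WithLp.measurable_toLp 2 (Fin d → ℝ)).comp
    (measurable_pi_iff.2 fun i => ?_ : Measurable fun a i => gradient (f a) x i)
  convert hcoord (EuclideanSpace.single i 1) using 2 with a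
  rw [(hdiff a).hasGradientAt.hasFDerivAt.fderiv, InnerProductSpace.toDual_apply_apply,
    EuclideanSpace.inner_single_right]
  simp

/-- **Minimizer of the importance-weighted denoising score matching objective.**
Define `J(s) = ∫∫ (q₀(x₀)/p₀(x₀)) ‖s(x) − ∇_x log k(x₀,x)‖² k(x₀,x) p₀(x₀) dx₀ dx` over
measurable vector fields `s : ℝ^d → ℝ^d`, and
`s*(x) = (∫ (q₀(x₀)/p₀(x₀)) ∇_x log k(x₀,x) p(x₀|x) dx₀) /
         (∫ (q₀(x₀)/p₀(x₀)) p(x₀|x) dx₀)`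
with `p(x₀|x) = k(x₀,x) p₀(x₀)/p_t(x)`. Then `J(s*) ≤ J(s)` for every measurable `s`
with `J(s) < ∞`: the importance-weighted posterior average of the conditional transition
score is a global minimizer of the importance-weighted denoising score matching
objective. (The objective is expressed as a lower integral of nonnegative integrands.) -/
theorem weighted_dsm_minimizer
    (d : ℕ) (hd : 0 < d)
    (p₀ q₀ : Euc d → ℝ) (k : Euc d → Euc d → ℝ) (pt qt : Euc d → ℝ)
    (hp₀pos : ∀ x₀, 0 < p₀ x₀) (hq₀pos : ∀ x₀, 0 < q₀ x₀)
    (hp₀meas : Measurable p₀) (hq₀meas : Measurable q₀)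
    (hp₀prob : ∫ x₀, p₀ x₀ = 1) (hq₀prob : ∫ x₀, q₀ x₀ = 1)
    (hkpos : ∀ x₀ x, 0 < k x₀ x)
    (hkmeas : Measurable (Function.uncurry k))
    (hkprob : ∀ x₀, ∫ x, k x₀ x = 1)
    (hkdiff : ∀ x₀, Differentiable ℝ fun x => k x₀ x)
    (hpt_int : ∀ x, Integrable fun x₀ => k x₀ x * p₀ x₀)
    (hqt_int : ∀ x, Integrable fun x₀ => k x₀ x * q₀ x₀)
    (hpt : ∀ x, pt x = ∫ x₀, k x₀ x * p₀ x₀)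
    (hqt : ∀ x, qt x = ∫ x₀, k x₀ x * q₀ x₀)
    (hJfin :
      (∫⁻ x, ∫⁻ x₀, ENNReal.ofReal ((q₀ x₀ / p₀ x₀) *
        (‖gradient (fun y => Real.log (k x₀ y)) x‖ ^ 2 * (k x₀ x * p₀ x₀)))) < ⊤)
    (sstar : Euc d → Euc d)
    (hsstar : ∀ x, sstar x
      = (∫ x₀, (q₀ x₀ / p₀ x₀) * (k x₀ x * p₀ x₀ / pt x))⁻¹ •
          ∫ x₀, ((q₀ x₀ / p₀ x₀) * (k x₀ x * p₀ x₀ / pt x)) •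
            gradient (fun y => Real.log (k x₀ y)) x) :
    ∀ s : Euc d → Euc d, Measurable s →
      (∫⁻ x, ∫⁻ x₀, ENNReal.ofReal ((q₀ x₀ / p₀ x₀) *
          (‖s x - gradient (fun y => Real.log (k x₀ y)) x‖ ^ 2 * (k x₀ x * p₀ x₀)))) < ⊤ →
      (∫⁻ x, ∫⁻ x₀, ENNReal.ofReal ((q₀ x₀ / p₀ x₀) *
          (‖sstar x - gradient (fun y => Real.log (k x₀ y)) x‖ ^ 2 * (k x₀ x * p₀ x₀))))
        ≤ ∫⁻ x, ∫⁻ x₀, ENNReal.ofReal ((q₀ x₀ / p₀ x₀) *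
            (‖s x - gradient (fun y => Real.log (k x₀ y)) x‖ ^ 2 * (k x₀ x * p₀ x₀))) := by
  intro s _ _
  refine lintegral_mono fun x => ?_
  have hpt_pos : 0 < pt x := by
    rw [hpt]
    exact integral_pos_of_forall_pos (hpt_int x) fun x₀ => mul_pos (hkpos x₀ x) (hp₀pos x₀)
  have hqt_pos : 0 < ∫ x₀, k x₀ x * q₀ x₀ :=
    integral_pos_of_forall_pos (hqt_int x) fun x₀ => mul_pos (hkpos x₀ x) (hq₀pos x₀)
  have hscore : Measurable fun x₀ => gradient (fun y => Real.log (k x₀ y)) x :=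
    measurable_gradient_param x
      (fun y => Real.measurable_log.comp (hkmeas.comp (measurable_id.prodMk measurable_const)))
      fun x₀ => (hkdiff x₀ x).log (hkpos x₀ x).ne'
  have hweight : ∀ x₀, q₀ x₀ / p₀ x₀ * (k x₀ x * p₀ x₀ / pt x)
      = (pt x)⁻¹ * (k x₀ x * q₀ x₀) := by
    intro x₀
    have := (hp₀pos x₀).ne'
    field_simp
  have hmean : sstar x = (∫ x₀, k x₀ x * q₀ x₀)⁻¹ •
      ∫ x₀, (k x₀ x * q₀ x₀) • gradient (fun y => Real.log (k x₀ y)) x := by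
    rw [hsstar]
    simp_rw [hweight, mul_smul (pt x)⁻¹]
    rw [integral_const_mul, integral_smul, smul_smul, mul_inv, inv_inv, mul_right_comm,
      mul_inv_cancel₀ hpt_pos.ne', one_mul]
  have hintegrand : ∀ (v : Euc d) x₀, q₀ x₀ / p₀ x₀ *
      (‖v - gradient (fun y => Real.log (k x₀ y)) x‖ ^ 2 * (k x₀ x * p₀ x₀))
      = k x₀ x * q₀ x₀ * ‖v - gradient (fun y => Real.log (k x₀ y)) x‖ ^ 2 := by
    intro v x₀
    have := (hp₀pos x₀).ne'
    field_simp
  simp only [hintegrand, hmean]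
  exact lintegral_norm_sub_weightedMean_sq_le (hqt_int x)
    (fun x₀ => (mul_pos (hkpos x₀ x) (hq₀pos x₀)).le) hqt_pos hscore.aestronglyMeasurable (s x)
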